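/- Let x be an element of a ring R such that the commutator [x, y] = xy − yx is addable for every y ∈ R. Then x is addable. Consequently, every ring in which every commutator is a sum of nilpotent elements is addable. -/

import Mathlib

/-- A brachymorphism between unital rings: `f (1 + x) = 1 + f x` and `f (x * y) = f x * f y`. -/
def IsBrachy {R S : Type*} [Ring R] [Ring S] (f : R → S) : Prop :=
  (∀ x : R, f (1 + x) = 1 + f x) ∧ (∀ x y : R, f (x * y) = f x * f y)

/-- An element `a` of `R` is addable if every brachymorphism from `R` to any ring
satisfies `f (a + x) = f a + f x`. -/
def Addable {R : Type*} [Ring R] (a : R) : Prop :=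
  ∀ (S : Type) (_ : Ring S) (f : R → S), IsBrachy f → ∀ x : R, f (a + x) = f a + f x

theorem IsBrachy.zero {R S : Type*} [Ring R] [Ring S] {f : R → S} (h : IsBrachy f) : f 0 = 0 := by
  have h1 : f 1 = 1 + f 0 := by simpa using h.1 0
  have h2 : f 0 = f 0 * f 1 := by simpa using h.2 0 1
  have h3 : f 0 = f 0 * f 0 := by simpa using h.2 0 0
  rw [h1, mul_add, mul_one, ← h3] at h2
  simpa using h2

/-- The key identity `f (x + y) * (f (x + y) - f x - f y) = 0`. -/
theorem brachy_key {R S : Type*} [Ring R] [Ring S] {f : R → S} (h : IsBrachy f) (x y : R)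
    (hc : ∀ y z : R, f ((x * y - y * x) + z) = f (x * y - y * x) + f z) :
    f (x + y) * (f (x + y) - f x - f y) = 0 := by
  have hcom : ∀ w, f (x * w - w * x) = f x * f w - f w * f x := by
    intro w
    have h1 := hc w (w * x)
    rw [sub_add_cancel, h.2, h.2] at h1
    rw [h1]; abel
  have hD : f (x + y) * f y = f y * f (x + y) + (f x * f y - f y * f x) := by
    have h1 := hc y (y * (x + y))
    rw [hcom, show x * y - y * x + y * (x + y) = (x + y) * y by noncomm_ring, h.2, h.2] at h1
    rw [h1]; abel
  have hE : f ((x + y) + x * (x + y) * y)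
      = (f x * (f x * f y) - (f x * f y) * f x) + (1 + f x * f y) * f (x + y) := by
    have h1 := hc (x * y) ((1 + x * y) * (x + y))
    rw [hcom, show x * (x * y) - x * y * x + (1 + x * y) * (x + y)
      = (x + y) + x * (x + y) * y by noncomm_ring, h.2 (1 + x * y), h.1, h.2 x y] at h1
    exact h1
  have hF : 1 + f (x + y) * f ((x + y) + x * (x + y) * y)
      = (1 + f (x + y) * f x) * (1 + f (x + y) * f y) := by
    rw [← h.2, ← h.1, ← h.2, ← h.2, ← h.1, ← h.1, ← h.2]
    congr 1
    noncomm_ring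
  rw [hE] at hF
  generalize f (x + y) = F at *
  generalize f x = X at *
  generalize f y = Y at *
  have e : F * (F - X - Y) =
      (1 + F * (X * (X * Y) - X * Y * X + (1 + X * Y) * F))
        - (1 + F * X) * (1 + F * Y)
        + F * X * (F * Y - (Y * F + (X * Y - Y * X))) := by noncomm_ring
  rw [e, hF, hD]; simp

theorem addable_of_comm {R : Type*} [Ring R] (x : R)
    (hx : ∀ y : R, Addable (x * y - y * x)) : Addable x := by
  intro S _ f h y
  have k1 := brachy_key h x y (fun y z => hx y S _ f h z)
  have k2 := brachy_key h (1 + x) y (fun y z => by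
    rw [show (1 + x) * y - y * (1 + x) = x * y - y * x by noncomm_ring]
    exact hx y S _ f h z)
  rw [add_assoc, h.1, h.1] at k2
  have e : f (x + y) - f x - f y = (1 + f (x + y)) * (1 + f (x + y) - (1 + f x) - f y)
    - f (x + y) * (f (x + y) - f x - f y) := by noncomm_ring
  rw [k1, k2, sub_zero, sub_sub, sub_eq_zero] at e
  exact e

theorem addable_nilpotent {R : Type*} [Ring R] (u : R) (hu : IsNilpotent u) : Addable u := by
  intro S _ f h y
  obtain ⟨v, hv⟩ := hu.isUnit_one_add
  have h1 : f (↑v * (1 + ↑v⁻¹ * (y - 1))) = f v + f (y - 1) := by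
    rw [h.2, h.1, mul_add, mul_one, ← h.2, Units.mul_inv_cancel_left]
  rw [mul_add, mul_one, Units.mul_inv_cancel_left, hv, h.1] at h1
  have h2 : f y = 1 + f (y - 1) := by rw [← h.1]; simp
  rw [h2, show u + y = 1 + u + (y - 1) by abel, h1]
  abel

theorem addable_sum {R : Type*} [Ring R] (l : List R) (hl : ∀ u ∈ l, Addable u) :
    Addable l.sum := by
  induction l with
  | nil =>
    intro S _ f h y
    simp [h.zero]
  | cons a l ih =>
    intro S _ f h y
    have ha := hl a (by simp) S _ f h
    have ih' := ih (fun u hu => hl u (by simp [hu])) S _ f h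
    rw [List.sum_cons, add_assoc, ha, ih', ha, add_assoc]

theorem stmt_18 {R : Type*} [Ring R] :
    (∀ x : R, (∀ y : R, Addable (x * y - y * x)) → Addable x) ∧
    ((∀ x y : R, ∃ l : List R, (∀ u ∈ l, IsNilpotent u) ∧ l.sum = x * y - y * x) →
      ∀ x : R, Addable x) := by
  refine ⟨addable_of_comm, fun H x => addable_of_comm x fun y => ?_⟩
  obtain ⟨l, hl, hs⟩ := H x y
  rw [← hs]
  exact addable_sum l fun u hu => addable_nilpotent u (hl u hu)
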